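/- arXiv:2306.03481 — 3 statements merged into one kernel-verified Lean document; each statement's English description precedes it below -/
import Mathlib

section
/- Let d ≥ 1 and let A, B be arbitrary d×d complex matrices. Then the integral of W ↦ Tr(W A W⁻¹ B) over the unitary group U(d) with respect to its Haar probability measure equals Tr(A)·Tr(B)/d. -/
open MeasureTheory Matrix

section UnitaryAverage

variable {n : Type*} [Fintype n] [DecidableEq n]

/-- The entries of a unitary conjugate of `A` are bounded uniformly in the unitary. -/
lemma norm_unitary_conj_apply_le (A : Matrix n n ℂ) (W : Matrix.unitaryGroup n ℂ) (i j : n) :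
    ‖((W : Matrix n n ℂ) * A * (W : Matrix n n ℂ)ᴴ) i j‖ ≤ ∑ l, ∑ k, ‖A k l‖ := by
  have hW := entry_norm_bound_of_unitary W.2
  rw [Matrix.mul_apply]
  refine (norm_sum_le _ _).trans (Finset.sum_le_sum fun l _ => ?_)
  rw [norm_mul, conjTranspose_apply, norm_star]
  refine (mul_le_of_le_one_right (norm_nonneg _) (hW j l)).trans ?_
  rw [Matrix.mul_apply]
  refine (norm_sum_le _ _).trans (Finset.sum_le_sum fun k _ => ?_)
  rw [norm_mul]
  exact mul_le_of_le_one_left (norm_nonneg _) (hW i k)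

lemma diagonal_mem_unitaryGroup {v : n → ℂ} (hv : ∀ i, v i * star (v i) = 1) :
    diagonal v ∈ Matrix.unitaryGroup n ℂ := by
  rw [Matrix.mem_unitaryGroup_iff, star_eq_conjTranspose, diagonal_conjTranspose,
    diagonal_mul_diagonal, ← diagonal_one]
  exact congrArg diagonal (funext hv)

lemma permMatrix_mem_unitaryGroup (σ : Equiv.Perm n) :
    σ.permMatrix ℂ ∈ Matrix.unitaryGroup n ℂ := by
  rw [Matrix.mem_unitaryGroup_iff, star_eq_conjTranspose, conjTranspose_permMatrix,
    ← permMatrix_mul, inv_mul_cancel, permMatrix_one]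

lemma trace_unitary_conj (A : Matrix n n ℂ) (W : Matrix.unitaryGroup n ℂ) :
    ((W : Matrix n n ℂ) * A * (W : Matrix n n ℂ)ᴴ).trace = A.trace := by
  rw [Matrix.trace_mul_comm, ← Matrix.mul_assoc, ← star_eq_conjTranspose,
    Matrix.mem_unitaryGroup_iff'.mp W.2, Matrix.one_mul]

variable [MeasurableSpace (Matrix.unitaryGroup n ℂ)] [BorelSpace (Matrix.unitaryGroup n ℂ)]
  (μ : Measure (Matrix.unitaryGroup n ℂ))

lemma integrable_unitary_conj_apply [IsFiniteMeasure μ] (A : Matrix n n ℂ) (i j : n) :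
    Integrable (fun W : Matrix.unitaryGroup n ℂ =>
      ((W : Matrix n n ℂ) * A * (W : Matrix n n ℂ)ᴴ) i j) μ := by
  have hc : Continuous fun W : Matrix.unitaryGroup n ℂ =>
      ((W : Matrix n n ℂ) * A * (W : Matrix n n ℂ)ᴴ) i j :=
    ((continuous_subtype_val.matrix_mul continuous_const).matrix_mul
      continuous_subtype_val.matrix_conjTranspose).matrix_elem i j
  exact .of_bound hc.aestronglyMeasurable _
    (.of_forall fun W => norm_unitary_conj_apply_le A W i j)

/-- Translating by `V` inside the average of `W A Wᴴ` conjugates the integrand by `V`. -/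
lemma integral_unitary_conj_apply_eq [μ.IsMulLeftInvariant] (A : Matrix n n ℂ)
    {V : Matrix n n ℂ} (hV : V ∈ Matrix.unitaryGroup n ℂ) (i j : n) :
    ∫ W : Matrix.unitaryGroup n ℂ, ((W : Matrix n n ℂ) * A * (W : Matrix n n ℂ)ᴴ) i j ∂μ =
      ∫ W : Matrix.unitaryGroup n ℂ,
        (V * ((W : Matrix n n ℂ) * A * (W : Matrix n n ℂ)ᴴ) * Vᴴ) i j ∂μ := by
  rw [← integral_mul_left_eq_self _ (⟨V, hV⟩ : Matrix.unitaryGroup n ℂ)]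
  simp only [Submonoid.coe_mul, conjTranspose_mul, Matrix.mul_assoc]

lemma integral_unitary_conj_apply_of_ne [μ.IsMulLeftInvariant] (A : Matrix n n ℂ)
    {i j : n} (hij : i ≠ j) :
    ∫ W : Matrix.unitaryGroup n ℂ,
      ((W : Matrix n n ℂ) * A * (W : Matrix n n ℂ)ᴴ) i j ∂μ = 0 := by
  have hv : ∀ k, (Function.update (1 : n → ℂ) i (-1)) k *
      star ((Function.update (1 : n → ℂ) i (-1)) k) = 1 := by
    intro k
    by_cases h : k = i <;> simp [h]
  have h := integral_unitary_conj_apply_eq μ A (diagonal_mem_unitaryGroup hv) i j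
  simp only [diagonal_conjTranspose, mul_diagonal, diagonal_mul] at h
  simp only [Function.update_self, Pi.star_apply, Function.update_of_ne hij.symm, Pi.one_apply,
    star_one, mul_one, neg_one_mul, integral_neg] at h
  exact self_eq_neg.mp h

lemma integral_unitary_conj_apply_self_eq [μ.IsMulLeftInvariant] (A : Matrix n n ℂ) (i j : n) :
    ∫ W : Matrix.unitaryGroup n ℂ, ((W : Matrix n n ℂ) * A * (W : Matrix n n ℂ)ᴴ) i i ∂μ =
      ∫ W : Matrix.unitaryGroup n ℂ,
        ((W : Matrix n n ℂ) * A * (W : Matrix n n ℂ)ᴴ) j j ∂μ := by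
  rw [integral_unitary_conj_apply_eq μ A (permMatrix_mem_unitaryGroup (Equiv.swap i j)) i i]
  simp [conjTranspose_permMatrix, Equiv.Perm.permMatrix, PEquiv.toMatrix_toPEquiv_mul,
    PEquiv.mul_toMatrix_toPEquiv, submatrix_apply]

lemma integral_unitary_conj_apply_self [IsProbabilityMeasure μ] [μ.IsMulLeftInvariant]
    (A : Matrix n n ℂ) (i : n) :
    ∫ W : Matrix.unitaryGroup n ℂ, ((W : Matrix n n ℂ) * A * (W : Matrix n n ℂ)ᴴ) i i ∂μ =
      A.trace / Fintype.card n := by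
  have : Nonempty n := ⟨i⟩
  rw [eq_div_iff (Nat.cast_ne_zero.mpr Fintype.card_ne_zero), mul_comm]
  calc _ = ∑ j, ∫ W : Matrix.unitaryGroup n ℂ,
        ((W : Matrix n n ℂ) * A * (W : Matrix n n ℂ)ᴴ) j j ∂μ := by
        rw [Finset.sum_congr rfl fun j _ => integral_unitary_conj_apply_self_eq μ A j i]
        simp
    _ = ∫ W : Matrix.unitaryGroup n ℂ,
        ((W : Matrix n n ℂ) * A * (W : Matrix n n ℂ)ᴴ).trace ∂μ :=
        (integral_finsetSum _ fun j _ => integrable_unitary_conj_apply μ A j j).symm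
    _ = A.trace := by simp [trace_unitary_conj]

end UnitaryAverage

/-- **Haar average of `Tr(W A W⁻¹ B)` over the unitary group.**
For `d ≥ 1` and arbitrary `d × d` complex matrices `A`, `B`, the integral of
`W ↦ Tr(W A W⁻¹ B)` over `U(d)` with respect to its Haar probability measure
equals `Tr(A)·Tr(B)/d`.  (For a unitary `W`, `W⁻¹ = Wᴴ`.) -/
theorem haar_integral_trace_conj (d : ℕ) (hd : 1 ≤ d)
    (A B : Matrix (Fin d) (Fin d) ℂ)
    [MeasurableSpace (Matrix.unitaryGroup (Fin d) ℂ)]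
    [BorelSpace (Matrix.unitaryGroup (Fin d) ℂ)]
    (μ : Measure (Matrix.unitaryGroup (Fin d) ℂ))
    [IsProbabilityMeasure μ] [μ.IsMulLeftInvariant] :
    ∫ W : Matrix.unitaryGroup (Fin d) ℂ,
        ((W : Matrix (Fin d) (Fin d) ℂ) * A * (W : Matrix (Fin d) (Fin d) ℂ)ᴴ * B).trace ∂μ
      = A.trace * B.trace / (d : ℂ) := by
  have hint (i j : Fin d) := (integrable_unitary_conj_apply μ A i j).mul_const (B j i)
  simp only [Matrix.trace, diag_apply, Matrix.mul_apply (N := B)]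
  rw [integral_finsetSum _ fun i _ => integrable_finsetSum _ fun j _ => hint i j,
    mul_div_right_comm, Finset.mul_sum]
  refine Finset.sum_congr rfl fun i _ => ?_
  rw [integral_finsetSum _ fun j _ => hint i j, Finset.sum_eq_single i]
  · rw [integral_mul_const, integral_unitary_conj_apply_self, Fintype.card_fin]
    rfl
  · intro j _ hji
    rw [integral_mul_const, integral_unitary_conj_apply_of_ne μ A hji.symm, zero_mul]
  · simp
end

section
/- (Fano's inequality.) Let S be a finite type with |S| ≥ 2, let (Ω, μ) be a probability space, and let X, X̂ : Ω → S be measurable random variables such that X is uniformly distributed on S. Then μ{ω : X̂(ω) ≠ X(ω)} ≥ 1 − (I[X : X̂] + log 2)/log|S|, where I[X : X̂] = H[X] + H[X̂] − H[(X, X̂)] is the mutual information and H denotes Shannon entropy with natural logarithm. -/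
open MeasureTheory

/-- The Shannon entropy (with natural logarithm) of a random variable `X : Ω → S`
taking values in a finite type, under the measure `μ`:
`H[X] = −∑ s, μ(X = s) log μ(X = s)`. -/
noncomputable def shannonEntropy {Ω S : Type*} [MeasurableSpace Ω] [Fintype S]
    (μ : Measure Ω) (X : Ω → S) : ℝ :=
  -∑ s : S, (μ (X ⁻¹' {s})).toReal * Real.log (μ (X ⁻¹' {s})).toReal

/-- The mutual information (with natural logarithm) between two random variables
`X, Y : Ω → S` taking values in a finite type, under the measure `μ`:
`I[X : Y] = H[X] + H[Y] − H[(X, Y)]`. -/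
noncomputable def mutualInfoRV {Ω S : Type*} [MeasurableSpace Ω] [Fintype S]
    (μ : Measure Ω) (X Y : Ω → S) : ℝ :=
  shannonEntropy μ X + shannonEntropy μ Y - shannonEntropy μ (fun ω => (X ω, Y ω))

lemma mul_log_add_sub_le_mul_log {p q : ℝ} (hp : 0 ≤ p) (hq : 0 ≤ q) (h : q = 0 → p = 0) :
    p * Real.log q + p - q ≤ p * Real.log p := by
  rcases hp.eq_or_lt with rfl | hp
  · simpa using hq
  have hq : 0 < q := hq.lt_of_ne fun h0 => hp.ne' (h h0.symm)
  have hlog := mul_le_mul_of_nonneg_left (Real.log_le_sub_one_of_pos (div_pos hq hp)) hp.le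
  rw [Real.log_div hq.ne' hp.ne', mul_sub, mul_sub, mul_div_cancel₀ _ hp.ne'] at hlog
  linarith

/-- Fano's inequality for a joint probability mass function: the conditional entropy of the first
coordinate given the second is at most `log 2` plus the off-diagonal mass times `log |S|`. -/
lemma sum_mul_log_marginal_sub_le {S : Type*} [Fintype S] [Nonempty S] (p : S → S → ℝ)
    (hp : ∀ x y, 0 ≤ p x y) (hsum : ∑ y, ∑ x, p x y = 1) :
    (∑ y, (∑ x, p x y) * Real.log (∑ x, p x y)) - ∑ y, ∑ x, p x y * Real.log (p x y) ≤
      Real.log 2 + (1 - ∑ s, p s s) * Real.log (Fintype.card S) := by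
  classical
  set n : ℝ := (Fintype.card S : ℝ) with hn
  have hn0 : 0 < n := by simp [hn, Fintype.card_pos]
  -- Compare `p` with the sub-probability mass function `m y * r x y`.
  let m : S → ℝ := fun y => ∑ x, p x y
  let r : S → S → ℝ := fun x y => if x = y then 1 / 2 else 1 / (2 * n)
  have hm : ∀ y, 0 ≤ m y := fun y => Finset.sum_nonneg fun x _ => hp x y
  have hr : ∀ x y, 0 < r x y := fun x y => by dsimp only [r]; split_ifs <;> positivity
  have hrsum : ∀ y, ∑ x, r x y ≤ 1 := fun y => by
    have hle : ∀ x, r x y ≤ (if x = y then 1 / 2 else 0) + 1 / (2 * n) := fun x => by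
      have : 0 < 1 / (2 * n) := by positivity
      dsimp only [r]; split_ifs <;> linarith
    refine (Finset.sum_le_sum fun x _ => hle x).trans_eq ?_
    rw [Finset.sum_add_distrib, Finset.sum_ite_eq' Finset.univ y]
    simp only [Finset.mem_univ, if_true, Finset.sum_const, Finset.card_univ, nsmul_eq_mul, ← hn]
    field_simp
    norm_num
  have hlogr : ∀ x y, Real.log (r x y) =
      -Real.log 2 - Real.log n + if x = y then Real.log n else 0 := fun x y => by
    dsimp only [r]
    split_ifs
    · simp
    · rw [one_div, Real.log_inv, Real.log_mul two_ne_zero hn0.ne']; ring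
  have hpt : ∀ x y, p x y * Real.log (m y) + p x y * (-Real.log 2 - Real.log n)
      + (if x = y then p x y * Real.log n else 0) + p x y - m y * r x y
        ≤ p x y * Real.log (p x y) := fun x y => by
    have hpm : m y = 0 → p x y = 0 := fun h =>
      (Finset.sum_eq_zero_iff_of_nonneg fun x _ => hp x y).1 h x (Finset.mem_univ x)
    have h := mul_log_add_sub_le_mul_log (hp x y) (mul_nonneg (hm y) (hr x y).le)
      fun h => hpm ((mul_eq_zero.1 h).resolve_right (hr x y).ne')
    refine le_trans (le_of_eq ?_) h
    by_cases h0 : m y = 0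
    · simp [hpm h0, h0]
    · rw [Real.log_mul h0 (hr x y).ne', hlogr]
      split_ifs <;> ring
  have hq : ∑ y, ∑ x, m y * r x y ≤ 1 := by
    rw [← hsum]
    refine Finset.sum_le_sum fun y _ => ?_
    rw [← Finset.mul_sum]
    exact mul_le_of_le_one_right (hm y) (hrsum y)
  have htotal := Finset.sum_le_sum fun y (_ : y ∈ Finset.univ) =>
    Finset.sum_le_sum fun x (_ : x ∈ Finset.univ) => hpt x y
  simp only [Finset.sum_sub_distrib, Finset.sum_add_distrib, ← Finset.sum_mul, hsum,
    Finset.sum_ite_eq', Finset.mem_univ, if_true] at htotal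
  linarith

lemma sum_measureReal_inter_preimage_singleton {Ω S : Type*} [MeasurableSpace Ω] [Fintype S]
    [MeasurableSpace S] [MeasurableSingletonClass S] (μ : Measure Ω) [IsFiniteMeasure μ]
    {Y : Ω → S} (hY : Measurable Y) (A : Set Ω) :
    ∑ y, μ.real (A ∩ Y ⁻¹' {y}) = μ.real A := by
  have h := sum_measureReal_preimage_singleton (μ := μ.restrict A) Finset.univ
    fun y _ => hY (measurableSet_singleton y)
  simpa [measureReal_restrict_apply (hY (measurableSet_singleton _)), Set.inter_comm] using h

lemma shannonEntropy_eq_log_card {Ω S : Type*} [MeasurableSpace Ω] [Fintype S] [Nonempty S]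
    (μ : Measure Ω) (X : Ω → S)
    (hunif : ∀ s : S, μ (X ⁻¹' {s}) = (Fintype.card S : ENNReal)⁻¹) :
    shannonEntropy μ X = Real.log (Fintype.card S) := by
  simp [shannonEntropy, hunif]

/-- **Fano's inequality.**  Let `S` be a finite type with `|S| ≥ 2`, let `(Ω, μ)` be a
probability space, and let `X, X̂ : Ω → S` be measurable random variables with `X`
uniformly distributed on `S`.  Then
`μ{ω : X̂ ω ≠ X ω} ≥ 1 − (I[X : X̂] + log 2)/log |S|`. -/
theorem fano_inequality {Ω S : Type*} [MeasurableSpace Ω] [Fintype S]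
    [MeasurableSpace S] [MeasurableSingletonClass S]
    (hS : 2 ≤ Fintype.card S)
    (μ : Measure Ω) [IsProbabilityMeasure μ]
    (X Xhat : Ω → S) (hX : Measurable X) (hXhat : Measurable Xhat)
    (hunif : ∀ s : S, μ (X ⁻¹' {s}) = (Fintype.card S : ENNReal)⁻¹) :
    (μ {ω | Xhat ω ≠ X ω}).toReal ≥
      1 - (mutualInfoRV μ X Xhat + Real.log 2) / Real.log (Fintype.card S) := by
  have : Nonempty S := Fintype.card_pos_iff.1 (by omega)
  have hlog : 0 < Real.log (Fintype.card S) := Real.log_pos (by exact_mod_cast hS)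
  let p : S → S → ℝ := fun x y => μ.real (X ⁻¹' {x} ∩ Xhat ⁻¹' {y})
  have hmarg : ∀ y, ∑ x, p x y = μ.real (Xhat ⁻¹' {y}) := fun y => by
    simpa only [p, Set.inter_comm] using
      sum_measureReal_inter_preimage_singleton μ hX (Xhat ⁻¹' {y})
  have hsum : ∑ y, ∑ x, p x y = 1 := by
    simpa [hmarg] using sum_measureReal_inter_preimage_singleton μ hXhat Set.univ
  have hdiag : μ.real {ω | Xhat ω ≠ X ω} = 1 - ∑ s, p s s := by
    have hmeas : MeasurableSet {ω | Xhat ω = X ω} := measurableSet_eq_fun hXhat hX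
    have hinter : ∀ s, {ω | Xhat ω = X ω} ∩ X ⁻¹' {s} = X ⁻¹' {s} ∩ Xhat ⁻¹' {s} := fun s => by
      ext ω
      simp only [Set.mem_inter_iff, Set.mem_ofPred_eq, Set.mem_preimage, Set.mem_singleton_iff]
      grind
    have hs := sum_measureReal_inter_preimage_singleton μ hX {ω | Xhat ω = X ω}
    simp only [hinter] at hs
    rw [hs, ← probReal_compl_eq_one_sub hmeas]
    rfl
  have hjoint : shannonEntropy μ (fun ω => (X ω, Xhat ω)) =
      -∑ y, ∑ x, p x y * Real.log (p x y) := by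
    have hpre : ∀ x y, (fun ω => (X ω, Xhat ω)) ⁻¹' {(x, y)} = X ⁻¹' {x} ∩ Xhat ⁻¹' {y} :=
      fun x y => by ext ω; simp
    simp only [shannonEntropy, Fintype.sum_prod_type_right, hpre, p, Measure.real]
  have hXhat_entropy : shannonEntropy μ Xhat =
      -∑ y, (∑ x, p x y) * Real.log (∑ x, p x y) := by
    simp only [shannonEntropy, hmarg, Measure.real]
  have hfano := sum_mul_log_marginal_sub_le p (fun _ _ => measureReal_nonneg) hsum
  change 1 - _ ≤ μ.real {ω | Xhat ω ≠ X ω}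
  rw [hdiag, mutualInfoRV, shannonEntropy_eq_log_card μ X hunif, hjoint, hXhat_entropy,
    sub_le_comm, le_div_iff₀ hlog]
  linarith
end

section
/- Let n ≥ 1, let u₁, …, uₙ ∈ ℝ, let σ² > 0, and for each x let P_x = N(u_x, σ²) be the Gaussian measure on ℝ with mean u_x and variance σ². Let P̄ = (1/n)·Σ_x P_x be the uniform mixture. Then (1/n)·Σ_{x=1}^n KL(P_x ‖ P̄) ≤ (1/n²)·Σ_{x=1}^n Σ_{x'=1}^n (u_x − u_{x'})²/(2σ²). -/
open MeasureTheory ProbabilityTheory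
open scoped ENNReal NNReal Classical

/-- The Kullback–Leibler divergence between two measures, with values in `ℝ≥0∞`:
it is `∫ log(dμ/dν) dμ` when `μ ≪ ν` and the log-likelihood ratio is integrable,
and `+∞` otherwise. -/
noncomputable def klDiv {α : Type*} [MeasurableSpace α] (μ ν : Measure α) : ℝ≥0∞ :=
  if μ ≪ ν ∧ Integrable (llr μ ν) μ then ENNReal.ofReal (∫ x, llr μ ν x ∂μ) else ⊤

/-- The logarithm of an average of positive reals is at least the average of the logarithms. -/
theorem average_log_le_log_average {n : ℕ} (hn : n ≠ 0) {f : Fin n → ℝ} (hf : ∀ i, 0 < f i) :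
    (n : ℝ)⁻¹ * ∑ i, Real.log (f i) ≤ Real.log ((n : ℝ)⁻¹ * ∑ i, f i) := by
  have h := strictConcaveOn_log_Ioi.concaveOn.le_map_sum (t := Finset.univ)
    (w := fun _ : Fin n => (n : ℝ)⁻¹) (p := f) (by intros; positivity)
    (by simp [hn]) (fun i _ => hf i)
  simpa [Finset.mul_sum] using h

theorem log_gaussianPDFReal (m : ℝ) {v : ℝ≥0} (hv : v ≠ 0) (y : ℝ) :
    Real.log (gaussianPDFReal m v y) =
      Real.log (√(2 * Real.pi * v))⁻¹ - (y - m) ^ 2 / (2 * v) := by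
  have hv' : (0 : ℝ) < v := by positivity
  rw [gaussianPDFReal, Real.log_mul (by positivity) (by positivity), Real.log_exp]
  ring

theorem gaussianPDFReal_le (m : ℝ) (v : ℝ≥0) (y : ℝ) :
    gaussianPDFReal m v y ≤ (√(2 * Real.pi * v))⁻¹ := by
  rw [gaussianPDFReal]
  refine mul_le_of_le_one_right (by positivity) (Real.exp_le_one_iff.2 ?_)
  rw [neg_div]
  exact neg_nonpos.2 (by positivity)

theorem average_gaussianPDFReal_pos {n : ℕ} (hn : n ≠ 0) (u : Fin n → ℝ) {v : ℝ≥0}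
    (hv : v ≠ 0) (y : ℝ) : 0 < (n : ℝ)⁻¹ * ∑ x, gaussianPDFReal (u x) v y := by
  have : NeZero n := ⟨hn⟩
  exact mul_pos (by positivity)
    (Finset.sum_pos (fun x _ => gaussianPDFReal_pos _ _ _ hv) Finset.univ_nonempty)

theorem average_gaussianPDFReal_le {n : ℕ} (hn : n ≠ 0) (u : Fin n → ℝ) (v : ℝ≥0) (y : ℝ) :
    (n : ℝ)⁻¹ * ∑ x, gaussianPDFReal (u x) v y ≤ (√(2 * Real.pi * v))⁻¹ := by
  rw [inv_mul_le_iff₀ (by positivity)]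
  simpa using Finset.sum_le_card_nsmul Finset.univ _ _ fun x _ => gaussianPDFReal_le (u x) v y

theorem average_gaussianReal_eq_withDensity {n : ℕ} (hn : n ≠ 0) (u : Fin n → ℝ) {v : ℝ≥0}
    (hv : v ≠ 0) :
    (n : ℝ≥0∞)⁻¹ • ∑ x, gaussianReal (u x) v =
      volume.withDensity
        (fun y => ENNReal.ofReal ((n : ℝ)⁻¹ * ∑ x, gaussianPDFReal (u x) v y)) := by
  have hd (y : ℝ) : ENNReal.ofReal ((n : ℝ)⁻¹ * ∑ x, gaussianPDFReal (u x) v y) =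
      (n : ℝ≥0∞)⁻¹ * ∑ x, gaussianPDF (u x) v y := by
    rw [ENNReal.ofReal_mul (by positivity), ENNReal.ofReal_inv_of_pos (by positivity),
      ENNReal.ofReal_natCast,
      ENNReal.ofReal_sum_of_nonneg (fun x _ => gaussianPDFReal_nonneg _ _ _)]
    rfl
  simp_rw [hd]
  ext s hs
  rw [withDensity_apply _ hs, lintegral_const_mul _ (by fun_prop),
    lintegral_finsetSum _ (by fun_prop)]
  simp [gaussianReal_apply _ hv]

theorem llr_gaussianReal_average_ae_eq {n : ℕ} (hn : n ≠ 0) (u : Fin n → ℝ) {v : ℝ≥0}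
    (hv : v ≠ 0) (m : ℝ) :
    llr (gaussianReal m v) ((n : ℝ≥0∞)⁻¹ • ∑ x, gaussianReal (u x) v) =ᵐ[gaussianReal m v]
      fun y => Real.log (gaussianPDFReal m v y) -
        Real.log ((n : ℝ)⁻¹ * ∑ x, gaussianPDFReal (u x) v y) := by
  have hpos := average_gaussianPDFReal_pos hn u hv
  refine (gaussianReal_absolutelyContinuous m hv).ae_le ?_
  rw [average_gaussianReal_eq_withDensity hn u hv]
  filter_upwards [Measure.rnDeriv_withDensity_right (gaussianReal m v) volume
    (f := fun y => ENNReal.ofReal ((n : ℝ)⁻¹ * ∑ x, gaussianPDFReal (u x) v y))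
    (by fun_prop) (ae_of_all _ fun y => (ENNReal.ofReal_pos.2 (hpos y)).ne')
    (ae_of_all _ fun _ => ENNReal.ofReal_ne_top), rnDeriv_gaussianReal m v] with y h1 h2
  rw [llr, h1, h2, ENNReal.toReal_mul, ENNReal.toReal_inv, toReal_gaussianPDF,
    ENNReal.toReal_ofReal (hpos y).le,
    Real.log_mul (inv_pos.2 (hpos y)).ne' (gaussianPDFReal_pos _ _ _ hv).ne', Real.log_inv]
  ring

/-- The log-likelihood ratio of `N(m, v)` against the mixture is at least `-(y - m)² / (2v)`. -/
theorem neg_sq_div_le_llr_gaussianReal_average {n : ℕ} (hn : n ≠ 0) (u : Fin n → ℝ) {v : ℝ≥0}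
    (hv : v ≠ 0) (m : ℝ) :
    ∀ᵐ y ∂gaussianReal m v, -((y - m) ^ 2 / (2 * v)) ≤
      llr (gaussianReal m v) ((n : ℝ≥0∞)⁻¹ • ∑ x, gaussianReal (u x) v) y := by
  filter_upwards [llr_gaussianReal_average_ae_eq hn u hv m] with y hy
  have := Real.log_le_log (average_gaussianPDFReal_pos hn u hv y)
    (average_gaussianPDFReal_le hn u v y)
  rw [hy, log_gaussianPDFReal m hv]
  linarith

/-- By Jensen's inequality, the log-likelihood ratio of `N(m, v)` against the mixture is at most
the average of the log-likelihood ratios against its components. -/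
theorem llr_gaussianReal_average_le {n : ℕ} (hn : n ≠ 0) (u : Fin n → ℝ) {v : ℝ≥0}
    (hv : v ≠ 0) (m : ℝ) :
    ∀ᵐ y ∂gaussianReal m v,
      llr (gaussianReal m v) ((n : ℝ≥0∞)⁻¹ • ∑ x, gaussianReal (u x) v) y ≤
        (n : ℝ)⁻¹ * ∑ x, ((m - u x) ^ 2 / (2 * v) + (m - u x) / v * (y - m)) := by
  filter_upwards [llr_gaussianReal_average_ae_eq hn u hv m] with y hy
  have hv' : (v : ℝ) ≠ 0 := by exact_mod_cast hv
  have hn' : (n : ℝ) ≠ 0 := by exact_mod_cast hn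
  have hJ := average_log_le_log_average hn fun x => gaussianPDFReal_pos (u x) v y hv
  have hsum : ∑ x, ((m - u x) ^ 2 / (2 * v) + (m - u x) / v * (y - m)) =
      n * Real.log (gaussianPDFReal m v y) - ∑ x, Real.log (gaussianPDFReal (u x) v y) := by
    have hconst : (n : ℝ) * Real.log (gaussianPDFReal m v y) =
        ∑ _x : Fin n, Real.log (gaussianPDFReal m v y) := by simp
    rw [hconst, ← Finset.sum_sub_distrib]
    refine Finset.sum_congr rfl fun x _ => ?_
    rw [log_gaussianPDFReal m hv, log_gaussianPDFReal (u x) hv]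
    field_simp
    ring
  rw [hy, hsum, mul_sub, inv_mul_cancel_left₀ hn']
  linarith

theorem integrable_sub_gaussianReal (m c : ℝ) (v : ℝ≥0) :
    Integrable (fun y => y - c) (gaussianReal m v) :=
  ((memLp_id_gaussianReal' 1 (by simp)).integrable le_rfl).sub (integrable_const c)

theorem integrable_sub_sq_gaussianReal (m c : ℝ) (v : ℝ≥0) :
    Integrable (fun y => (y - c) ^ 2) (gaussianReal m v) :=
  ((memLp_id_gaussianReal' 2 (by simp)).sub (memLp_const c)).integrable_sq

theorem integrable_average_llr_gaussianReal {n : ℕ} (u : Fin n → ℝ) (v : ℝ≥0) (m : ℝ) :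
    Integrable
      (fun y => (n : ℝ)⁻¹ * ∑ x, ((m - u x) ^ 2 / (2 * v) + (m - u x) / v * (y - m)))
      (gaussianReal m v) :=
  (integrable_finsetSum _ fun _ _ =>
    (integrable_const _).add ((integrable_sub_gaussianReal m m v).const_mul _)).const_mul _

theorem integral_average_llr_gaussianReal {n : ℕ} (u : Fin n → ℝ) (v : ℝ≥0) (m : ℝ) :
    ∫ y, (n : ℝ)⁻¹ * ∑ x, ((m - u x) ^ 2 / (2 * v) + (m - u x) / v * (y - m)) ∂gaussianReal m v =
      (n : ℝ)⁻¹ * ∑ x, (m - u x) ^ 2 / (2 * v) := by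
  have hint := integrable_sub_gaussianReal m m v
  have hzero : ∫ y, (y - m) ∂gaussianReal m v = 0 := by
    have hid : Integrable (fun y => y) (gaussianReal m v) :=
      (memLp_id_gaussianReal' 1 (by simp)).integrable le_rfl
    rw [integral_sub hid (integrable_const m)]
    simp
  rw [integral_const_mul, integral_finsetSum]
  swap
  · exact fun x _ => (integrable_const _).add (hint.const_mul _)
  congr 1
  refine Finset.sum_congr rfl fun x _ => ?_
  rw [integral_add (integrable_const _) (hint.const_mul _), integral_const_mul, hzero]
  simp

theorem integrable_llr_gaussianReal_average {n : ℕ} (hn : n ≠ 0) (u : Fin n → ℝ) {v : ℝ≥0}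
    (hv : v ≠ 0) (m : ℝ) :
    Integrable (llr (gaussianReal m v) ((n : ℝ≥0∞)⁻¹ • ∑ x, gaussianReal (u x) v))
      (gaussianReal m v) :=
  integrable_of_le_of_le (measurable_llr _ _).aestronglyMeasurable
    (neg_sq_div_le_llr_gaussianReal_average hn u hv m) (llr_gaussianReal_average_le hn u hv m)
    ((integrable_sub_sq_gaussianReal m m v).div_const _).neg (integrable_average_llr_gaussianReal u v m)

theorem gaussianReal_absolutelyContinuous_average {n : ℕ} (hn : n ≠ 0) (u : Fin n → ℝ)
    {v : ℝ≥0} (hv : v ≠ 0) (m : ℝ) :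
    gaussianReal m v ≪ (n : ℝ≥0∞)⁻¹ • ∑ x, gaussianReal (u x) v := by
  rw [average_gaussianReal_eq_withDensity hn u hv]
  exact (gaussianReal_absolutelyContinuous m hv).trans
    (withDensity_absolutelyContinuous' (by fun_prop)
      (ae_of_all _ fun y => (ENNReal.ofReal_pos.2 (average_gaussianPDFReal_pos hn u hv y)).ne'))

theorem klDiv_gaussianReal_average_le {n : ℕ} (hn : n ≠ 0) (u : Fin n → ℝ) {v : ℝ≥0}
    (hv : v ≠ 0) (m : ℝ) :
    klDiv (gaussianReal m v) ((n : ℝ≥0∞)⁻¹ • ∑ x, gaussianReal (u x) v) ≤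
      (n : ℝ≥0∞)⁻¹ * ∑ x, ENNReal.ofReal ((m - u x) ^ 2 / (2 * (v : ℝ))) := by
  have hint := integrable_llr_gaussianReal_average hn u hv m
  rw [klDiv, if_pos ⟨gaussianReal_absolutelyContinuous_average hn u hv m, hint⟩]
  refine (ENNReal.ofReal_le_ofReal (integral_mono_ae hint (integrable_average_llr_gaussianReal u v m)
    (llr_gaussianReal_average_le hn u hv m))).trans_eq ?_
  rw [integral_average_llr_gaussianReal, ENNReal.ofReal_mul (by positivity),
    ENNReal.ofReal_inv_of_pos (by positivity), ENNReal.ofReal_natCast,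
    ENNReal.ofReal_sum_of_nonneg (fun x _ => by positivity)]

/-- **Mutual-information bound for Gaussian measurement outputs.**
Let `u₁, …, uₙ ∈ ℝ`, `σ² > 0`, `Pₓ = N(uₓ, σ²)`, and `P̄ = (1/n)·∑ₓ Pₓ` the uniform
mixture.  Then `(1/n)·∑ₓ KL(Pₓ ‖ P̄) ≤ (1/n²)·∑ₓ ∑ₓ' (uₓ − uₓ')²/(2σ²)`. -/
theorem avg_klDiv_gaussian_mixture_le (n : ℕ) (hn : 1 ≤ n)
    (u : Fin n → ℝ) (σSq : ℝ≥0) (hσ : 0 < σSq)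
    (P : Fin n → Measure ℝ) (hP : ∀ x, P x = gaussianReal (u x) σSq)
    (Pbar : Measure ℝ) (hPbar : Pbar = (n : ℝ≥0∞)⁻¹ • ∑ x : Fin n, P x) :
    (n : ℝ≥0∞)⁻¹ * ∑ x : Fin n, klDiv (P x) Pbar ≤
      ((n : ℝ≥0∞) ^ 2)⁻¹ *
        ∑ x : Fin n, ∑ x' : Fin n,
          ENNReal.ofReal ((u x - u x') ^ 2 / (2 * (σSq : ℝ))) := by
  subst hPbar
  obtain rfl : P = fun x => gaussianReal (u x) σSq := funext hP
  have hn' : n ≠ 0 := by omega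
  calc
    _ ≤ (n : ℝ≥0∞)⁻¹ * ∑ x, (n : ℝ≥0∞)⁻¹ *
          ∑ x', ENNReal.ofReal ((u x - u x') ^ 2 / (2 * (σSq : ℝ))) := by
      gcongr with x
      exact klDiv_gaussianReal_average_le hn' u hσ.ne' (u x)
    _ = _ := by
      rw [← Finset.mul_sum, ← mul_assoc, ENNReal.inv_pow, sq]
end
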